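/- For all integers p, q ≥ 0, every f ∈ V_{p,q} can be written uniquely as a finite sum f = Σ_{k=0}^{min(p,q)} ‖z‖^{2k}·h_k with h_k ∈ H_{p−k,q−k}; that is, V_{p,q} = ⊕_{k=0}^{min(p,q)} ‖z‖^{2k}·H_{p−k,q−k} as a direct sum of ℂ-subspaces. -/

import Mathlib

open MvPolynomial

noncomputable section

/-- The polynomial ring `𝒫 = ℂ[z₁,z₂,z̄₁,z̄₂]`, with variables indexed so that
`X 0 = z₁`, `X 1 = z₂`, `X 2 = z̄₁`, `X 3 = z̄₂`. -/
abbrev P4 : Type := MvPolynomial (Fin 4) ℂ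

/-- The Laplacian `Δ = ∂²/∂z₁∂z̄₁ + ∂²/∂z₂∂z̄₂`. -/
def lap (f : P4) : P4 :=
  pderiv (2 : Fin 4) (pderiv (0 : Fin 4) f) + pderiv (3 : Fin 4) (pderiv (1 : Fin 4) f)

/-- The polynomial `‖z‖² = z₁z̄₁ + z₂z̄₂`. -/
def normSqPoly : P4 := X 0 * X 2 + X 1 * X 3

/-- `f` is bihomogeneous of bidegree `(p,q)`: every monomial occurring in it has total
degree `p` in `(z₁,z₂)` and total degree `q` in `(z̄₁,z̄₂)`.  The set of such `f` is `V_{p,q}`. -/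
def IsBihom (p q : ℕ) (f : P4) : Prop :=
  ∀ d ∈ f.support, d 0 + d 1 = p ∧ d 2 + d 3 = q

lemma IsBihom.add' {p q : ℕ} {f g : P4} (hf : IsBihom p q f) (hg : IsBihom p q g) :
    IsBihom p q (f + g) := by
  classical
  intro d hd
  rcases Finset.mem_union.1 (support_add hd) with h | h
  · exact hf d h
  · exact hg d h

lemma IsBihom.sub' {p q : ℕ} {f g : P4} (hf : IsBihom p q f) (hg : IsBihom p q g) :
    IsBihom p q (f - g) := by
  classical
  intro d hd
  rcases Finset.mem_union.1 (support_sub _ f g hd) with h | h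
  · exact hf d h
  · exact hg d h

lemma IsBihom.zero' (p q : ℕ) : IsBihom p q 0 := by
  intro d hd
  simp at hd

lemma IsBihom.cmul {p q : ℕ} {f : P4} (c : ℂ) (hf : IsBihom p q f) :
    IsBihom p q (C c * f) := by
  intro d hd
  apply hf d
  rw [mem_support_iff] at hd ⊢
  rw [coeff_C_mul] at hd
  exact right_ne_zero_of_mul hd

lemma IsBihom.sum' {p q : ℕ} (s : Finset ℕ) (F : ℕ → P4) (h : ∀ k ∈ s, IsBihom p q (F k)) :
    IsBihom p q (∑ k ∈ s, F k) := by
  classical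
  induction s using Finset.induction_on with
  | empty => simpa using IsBihom.zero' p q
  | insert a s ha ih =>
    rw [Finset.sum_insert ha]
    exact (h a (by simp)).add' (ih fun k hk => h k (by simp [hk]))

lemma IsBihom.mul' {p q p' q' : ℕ} {f g : P4} (hf : IsBihom p q f) (hg : IsBihom p' q' g) :
    IsBihom (p + p') (q + q') (f * g) := by
  classical
  intro d hd
  obtain ⟨a, ha, b, hb, rfl⟩ := Finset.mem_add.1 (support_mul f g hd)
  have h1 := hf a ha
  have h2 := hg b hb
  simp only [Finsupp.add_apply]
  omega

lemma bihom_monomial_XX (i j : Fin 4) (h : (i = 0 ∧ j = 2) ∨ (i = 1 ∧ j = 3)) :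
    IsBihom 1 1 (X i * X j : P4) := by
  intro d hd
  have e : (X i * X j : P4) = monomial (Finsupp.single i 1 + Finsupp.single j 1) 1 := by
    simp [X, monomial_mul]
  rw [e] at hd
  have := Finset.mem_singleton.1 (support_monomial_subset hd)
  subst this
  rcases h with ⟨rfl, rfl⟩ | ⟨rfl, rfl⟩ <;> simp

lemma bihom_normSq : IsBihom 1 1 normSqPoly :=
  (bihom_monomial_XX 0 2 (by simp)).add' (bihom_monomial_XX 1 3 (by simp))

lemma bihom_normSq_pow (k : ℕ) : IsBihom k k (normSqPoly ^ k) := by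
  induction k with
  | zero =>
    intro d hd
    rw [pow_zero] at hd
    have : d = 0 := by
      rw [mem_support_iff, coeff_one] at hd
      by_contra h
      exact hd (if_neg (Ne.symm h))
    subst this
    simp
  | succ k ih =>
    rw [pow_succ]
    exact ih.mul' bihom_normSq

lemma coeff_lap (f : P4) (m : Fin 4 →₀ ℕ) (h : coeff m (lap f) ≠ 0) :
    ∃ d ∈ f.support, d 0 + d 1 = m 0 + m 1 + 1 ∧ d 2 + d 3 = m 2 + m 3 + 1 := by
  rw [lap, coeff_add, coeff_pderiv, coeff_pderiv, coeff_pderiv, coeff_pderiv] at h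
  by_cases h1 : coeff (m + Finsupp.single 2 1 + Finsupp.single 0 1) f = 0
  · by_cases h2 : coeff (m + Finsupp.single 3 1 + Finsupp.single 1 1) f = 0
    · simp [h1, h2] at h
    · refine ⟨_, mem_support_iff.2 h2, ?_⟩
      simp
      omega
  · refine ⟨_, mem_support_iff.2 h1, ?_⟩
    simp
    omega

lemma IsBihom.lap' {p q : ℕ} {f : P4} (hf : IsBihom (p + 1) (q + 1) f) :
    IsBihom p q (lap f) := by
  intro m hm
  obtain ⟨d, hd, h1, h2⟩ := coeff_lap f m (mem_support_iff.1 hm)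
  have := hf d hd
  omega

lemma IsBihom.lap_eq_zero {p q : ℕ} {f : P4} (hf : IsBihom p q f) (h : p = 0 ∨ q = 0) :
    lap f = 0 := by
  ext m
  rw [coeff_zero]
  by_contra hm
  obtain ⟨d, hd, h1, h2⟩ := coeff_lap f m hm
  have := hf d hd
  omega

lemma euler1 {p q : ℕ} {f : P4} (hf : IsBihom p q f) :
    X 0 * pderiv 0 f + X 1 * pderiv 1 f = (p : P4) * f := by
  have hw : IsWeightedHomogeneous (![1, 1, 0, 0] : Fin 4 → ℕ) f p := by
    intro d hd
    have := hf d (mem_support_iff.2 hd)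
    rw [Finsupp.weight_apply, Finsupp.sum_fintype _ _ (by simp), Fin.sum_univ_four]
    simp
    omega
  have := hw.sum_weight_X_mul_pderiv
  rw [Fin.sum_univ_four] at this
  simpa using this

lemma euler2 {p q : ℕ} {f : P4} (hf : IsBihom p q f) :
    X 2 * pderiv 2 f + X 3 * pderiv 3 f = (q : P4) * f := by
  have hw : IsWeightedHomogeneous (![0, 0, 1, 1] : Fin 4 → ℕ) f q := by
    intro d hd
    have := hf d (mem_support_iff.2 hd)
    rw [Finsupp.weight_apply, Finsupp.sum_fintype _ _ (by simp), Fin.sum_univ_four]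
    simp
    omega
  have := hw.sum_weight_X_mul_pderiv
  rw [Fin.sum_univ_four] at this
  simpa using this

lemma lap_add (f g : P4) : lap (f + g) = lap f + lap g := by
  simp only [lap, map_add]; ring

lemma lap_sub (f g : P4) : lap (f - g) = lap f - lap g := by
  simp only [lap, map_sub]; ring

lemma lap_zero : lap 0 = 0 := by simp [lap]

lemma lap_cmul (c : ℂ) (f : P4) : lap (C c * f) = C c * lap f := by
  simp only [lap, pderiv_C_mul]; ring

lemma lap_sum (s : Finset ℕ) (F : ℕ → P4) : lap (∑ k ∈ s, F k) = ∑ k ∈ s, lap (F k) := by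
  simp only [lap, map_sum, Finset.sum_add_distrib]

lemma lap_normSq_mul {p q : ℕ} {f : P4} (hf : IsBihom p q f) :
    lap (normSqPoly * f) = normSqPoly * lap f + ((p : P4) + q + 2) * f := by
  have h1 := euler1 hf
  have h2 := euler2 hf
  have e : lap (normSqPoly * f) = normSqPoly * lap f +
      (X 0 * pderiv 0 f + X 1 * pderiv 1 f) + (X 2 * pderiv 2 f + X 3 * pderiv 3 f) + 2 * f := by
    simp only [lap, normSqPoly, pderiv_mul, map_add, pderiv_X, Pi.single_apply]
    simp
    ring
  rw [e, h1, h2]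
  ring

lemma lap_pow_mul {a b : ℕ} {h : P4} (hb : IsBihom a b h) (h0 : lap h = 0) (k : ℕ) :
    lap (normSqPoly ^ (k + 1) * h) =
      C (((k + 1) * (a + b + k + 2) : ℕ) : ℂ) * (normSqPoly ^ k * h) := by
  induction k with
  | zero =>
    rw [zero_add, pow_one, lap_normSq_mul hb, h0]
    simp only [map_natCast]
    push_cast
    ring
  | succ k ih =>
    have e : normSqPoly ^ (k + 1 + 1) * h = normSqPoly * (normSqPoly ^ (k + 1) * h) := by ring
    rw [e, lap_normSq_mul ((bihom_normSq_pow (k + 1)).mul' hb), ih]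
    simp only [map_natCast]
    push_cast
    ring

lemma exists_decomp (p : ℕ) : ∀ (q : ℕ) (f : P4), IsBihom p q f →
    ∃ h : ℕ → P4,
        (∀ k ≤ min p q, IsBihom (p - k) (q - k) (h k) ∧ lap (h k) = 0) ∧
        f = ∑ k ∈ Finset.range (min p q + 1), normSqPoly ^ k * h k := by
  have base : ∀ (p q : ℕ) (f : P4), (p = 0 ∨ q = 0) → IsBihom p q f → ∃ h : ℕ → P4,
        (∀ k ≤ min p q, IsBihom (p - k) (q - k) (h k) ∧ lap (h k) = 0) ∧
        f = ∑ k ∈ Finset.range (min p q + 1), normSqPoly ^ k * h k := by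
    intro p q f h0 hf
    have hm : min p q = 0 := by omega
    refine ⟨fun _ => f, ?_, by simp [hm]⟩
    intro k hk
    have : k = 0 := by omega
    subst this
    exact ⟨hf, hf.lap_eq_zero h0⟩
  induction p with
  | zero => exact fun q f hf => base 0 q f (Or.inl rfl) hf
  | succ p ih =>
    intro q f hf
    rcases q with _ | q
    · exact base _ _ f (Or.inr rfl) hf
    obtain ⟨h, hh, hs⟩ := ih q (lap f) hf.lap'
    have hm : min (p + 1) (q + 1) = min p q + 1 := by omega
    set c : ℕ → ℂ := fun k => (((k + 1) * ((p - k) + (q - k) + k + 2) : ℕ) : ℂ) with hc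
    have hc0 : ∀ k, c k ≠ 0 := fun k => Nat.cast_ne_zero.2 (by positivity)
    set g : ℕ → P4 := fun k => C (c k)⁻¹ * h k with hg
    have hgb : ∀ k ≤ min p q, IsBihom (p - k) (q - k) (g k) ∧ lap (g k) = 0 := fun k hk =>
      ⟨(hh k hk).1.cmul _, by rw [hg, lap_cmul, (hh k hk).2, mul_zero]⟩
    set G : P4 := ∑ k ∈ Finset.range (min p q + 1), normSqPoly ^ (k + 1) * g k with hG
    have hGb : IsBihom (p + 1) (q + 1) G := by
      apply IsBihom.sum'
      intro k hk
      have hk' : k ≤ min p q := by simpa [Nat.lt_succ_iff] using hk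
      have := (bihom_normSq_pow (k + 1)).mul' (hgb k hk').1
      have e1 : k + 1 + (p - k) = p + 1 := by omega
      have e2 : k + 1 + (q - k) = q + 1 := by omega
      rwa [e1, e2] at this
    have hGl : lap G = lap f := by
      rw [hs, hG, lap_sum]
      refine Finset.sum_congr rfl fun k hk => ?_
      have hk' : k ≤ min p q := by have := Finset.mem_range.1 hk; omega
      rw [lap_pow_mul (hgb k hk').1 (hgb k hk').2]
      have : (C (c k) : P4) * C (c k)⁻¹ = 1 := by
        rw [← C_mul, mul_inv_cancel₀ (hc0 k), C_1]
      calc _ = (C (c k) * C (c k)⁻¹) * (normSqPoly ^ k * h k) := by simp only [hg, hc]; ring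
        _ = _ := by rw [this, one_mul]
    refine ⟨fun k => Nat.casesOn k (f - G) g, ?_, ?_⟩
    · intro k hk
      rcases k with _ | k
      · exact ⟨hf.sub' hGb, by
          change lap (f - G) = 0
          rw [lap_sub, hGl, sub_self]⟩
      · simpa using hgb k (by omega)
    · rw [hm, Finset.sum_range_succ']
      simp only [pow_zero, one_mul]
      change f = G + (f - G)
      ring

lemma unique_decomp (p : ℕ) : ∀ (q : ℕ) (h : ℕ → P4),
    (∀ k ≤ min p q, IsBihom (p - k) (q - k) (h k) ∧ lap (h k) = 0) →
    ∑ k ∈ Finset.range (min p q + 1), normSqPoly ^ k * h k = 0 → ∀ k ≤ min p q, h k = 0 := by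
  have base : ∀ (p q : ℕ) (h : ℕ → P4), (p = 0 ∨ q = 0) →
      ∑ k ∈ Finset.range (min p q + 1), normSqPoly ^ k * h k = 0 → ∀ k ≤ min p q, h k = 0 := by
    intro p q h h0 hs k hk
    have hm : min p q = 0 := by omega
    have : k = 0 := by omega
    subst this
    simpa [hm] using hs
  induction p with
  | zero => exact fun q h _ hs => base 0 q h (Or.inl rfl) hs
  | succ p ih =>
    intro q h hh hs
    rcases q with _ | q
    · exact base _ _ h (Or.inr rfl) hs
    have hm : min (p + 1) (q + 1) = min p q + 1 := by omega
    rw [hm] at hs hh ⊢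
    set c : ℕ → ℂ := fun k => (((k + 1) * ((p - k) + (q - k) + k + 2) : ℕ) : ℂ) with hc
    have hc0 : ∀ k, c k ≠ 0 := fun k => Nat.cast_ne_zero.2 (by positivity)
    have hh' : ∀ k ≤ min p q, IsBihom (p - k) (q - k) (h (k + 1)) ∧ lap (h (k + 1)) = 0 := by
      intro k hk
      have := hh (k + 1) (by omega)
      simpa using this
    rw [Finset.sum_range_succ'] at hs
    have hl := congrArg lap hs
    rw [lap_add, lap_sum, pow_zero, one_mul, (hh 0 (by omega)).2, lap_zero, add_zero] at hl
    have key := ih q (fun k => C (c k) * h (k + 1))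
      (fun k hk => ⟨(hh' k hk).1.cmul _, by rw [lap_cmul, (hh' k hk).2, mul_zero]⟩) (by
        rw [← hl]
        refine Finset.sum_congr rfl fun k hk => ?_
        have hk' : k ≤ min p q := by have := Finset.mem_range.1 hk; omega
        rw [lap_pow_mul (hh' k hk').1 (hh' k hk').2]
        simp only [hc]
        ring)
    have hz : ∀ k ≤ min p q, h (k + 1) = 0 := by
      intro k hk
      rcases mul_eq_zero.1 (key k hk) with h1 | h1
      · exact absurd (C_eq_zero.1 h1) (hc0 k)
      · exact h1
    intro k hk
    rcases k with _ | k
    · rw [Finset.sum_eq_zero] at hs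
      · simpa using hs
      · intro k hk
        rw [hz k (by have := Finset.mem_range.1 hk; omega), mul_zero]
    · exact hz k (by omega)

/-- Every `f ∈ V_{p,q}` is uniquely a finite sum `f = Σ_{k=0}^{min(p,q)} ‖z‖^{2k}·h_k` with
`h_k ∈ H_{p−k,q−k}`; i.e. `V_{p,q} = ⊕_{k=0}^{min(p,q)} ‖z‖^{2k}·H_{p−k,q−k}`. -/
theorem stmt_3 (p q : ℕ) (f : P4) (hf : IsBihom p q f) :
    (∃ h : ℕ → P4,
        (∀ k ≤ min p q, IsBihom (p - k) (q - k) (h k) ∧ lap (h k) = 0) ∧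
        f = ∑ k ∈ Finset.range (min p q + 1), normSqPoly ^ k * h k) ∧
    (∀ h h' : ℕ → P4,
        (∀ k ≤ min p q, IsBihom (p - k) (q - k) (h k) ∧ lap (h k) = 0) →
        (∀ k ≤ min p q, IsBihom (p - k) (q - k) (h' k) ∧ lap (h' k) = 0) →
        f = ∑ k ∈ Finset.range (min p q + 1), normSqPoly ^ k * h k →
        f = ∑ k ∈ Finset.range (min p q + 1), normSqPoly ^ k * h' k →
        ∀ k ≤ min p q, h k = h' k) := by
  refine ⟨exists_decomp p q f hf, ?_⟩
  intro h h' hh hh' hs hs' k hk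
  have := unique_decomp p q (fun k => h k - h' k)
    (fun k hk => ⟨(hh k hk).1.sub' (hh' k hk).1, by
      rw [lap_sub, (hh k hk).2, (hh' k hk).2, sub_zero]⟩)
    (by simp only [mul_sub, Finset.sum_sub_distrib]; rw [← hs, ← hs', sub_self]) k hk
  exact sub_eq_zero.1 this
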